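/- arXiv:2201.00609 — 2 statements merged into one kernel-verified Lean document; each statement's English description precedes it below -/
import Mathlib

section
/- Let θ_j^{(k)} denote the DOC kernels associated with the BDF-k kernels. Then for every m ≥ 1 and all real numbers v₁, …, v_m: 2·∑_{ℓ=1}^{m} ∑_{j=1}^{ℓ} θ_{ℓ−j}^{(3)} v_j v_ℓ ≤ (35/12)·∑_{ℓ=1}^{m} v_ℓ²; 2·∑_{ℓ=1}^{m} ∑_{j=1}^{ℓ} θ_{ℓ−j}^{(4)} v_j v_ℓ ≤ 7·∑_{ℓ=1}^{m} v_ℓ²; and 2·∑_{ℓ=1}^{m} ∑_{j=1}^{ℓ} θ_{ℓ−j}^{(5)} v_j v_ℓ ≤ (168/5)·∑_{ℓ=1}^{m} v_ℓ². -/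
noncomputable def bdf3 : ℕ → ℝ
  | 0 => 11/6
  | 1 => -(7/6)
  | 2 => 1/3
  | _ => 0

noncomputable def bdf4 : ℕ → ℝ
  | 0 => 25/12
  | 1 => -(23/12)
  | 2 => 13/12
  | 3 => -(1/4)
  | _ => 0

noncomputable def bdf5 : ℕ → ℝ
  | 0 => 137/60
  | 1 => -(163/60)
  | 2 => 137/60
  | 3 => -(21/20)
  | 4 => 1/5
  | _ => 0

/-- The DOC kernels associated with kernels `b`:
`θ₀ = 1/b₀` and `θ_j = -(1/b₀) * ∑_{s=1}^{j} θ_{j-s} b_s` for `j ≥ 1`. -/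
noncomputable def doc (b : ℕ → ℝ) : ℕ → ℝ
  | 0 => 1 / b 0
  | j+1 => -(1 / b 0) * ∑ s ∈ (Finset.Icc 1 (j+1)).attach, doc b ((j+1) - s.1) * b s.1
  decreasing_by
    have h := Finset.mem_Icc.mp s.2
    omega

/-- The DOC convolution `w_n = ∑_{j=1}^{n} θ_{n-j} v_j`. -/
noncomputable def docConv (b v : ℕ → ℝ) (n : ℕ) : ℝ :=
  ∑ j ∈ Finset.Icc 1 n, doc b (n - j) * v j

theorem docConv_zero (b v : ℕ → ℝ) : docConv b v 0 = 0 := by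
  simp [docConv]

theorem sum_Icc_one_eq_sum_range (f : ℕ → ℝ) (n : ℕ) :
    ∑ j ∈ Finset.Icc 1 n, f j = ∑ j ∈ Finset.range n, f (j + 1) := by
  rw [Finset.range_eq_Ico, Finset.sum_Ico_add' f 0 n 1]
  rfl

theorem doc_succ (b : ℕ → ℝ) (n : ℕ) :
    doc b (n + 1) = -(1 / b 0) * ∑ s ∈ Finset.range (n + 1), doc b (n - s) * b (s + 1) := by
  rw [doc, Finset.sum_attach (Finset.Icc 1 (n + 1)) fun s => doc b (n + 1 - s) * b s,
    sum_Icc_one_eq_sum_range]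
  simp only [Nat.add_sub_add_right]

theorem mk_mul_mk_doc {b : ℕ → ℝ} (hb : b 0 ≠ 0) :
    PowerSeries.mk b * PowerSeries.mk (doc b) = 1 := by
  ext n
  rw [PowerSeries.coeff_mul, PowerSeries.coeff_one]
  simp only [PowerSeries.coeff_mk]
  rw [Finset.Nat.sum_antidiagonal_eq_sum_range_succ fun i j => b i * doc b j]
  cases n with
  | zero => simp [doc, hb]
  | succ n =>
    rw [Nat.succ_eq_add_one, Finset.sum_range_succ', Nat.sub_zero, doc_succ]
    simp only [Nat.add_sub_add_right, mul_comm (doc b _)]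
    field_simp
    simp

theorem mk_docConv (b v : ℕ → ℝ) :
    PowerSeries.mk (docConv b v) =
      PowerSeries.mk (doc b) * PowerSeries.mk fun n => if n = 0 then 0 else v n := by
  ext n
  rw [mul_comm, PowerSeries.coeff_mul]
  simp only [PowerSeries.coeff_mk]
  rw [Finset.Nat.sum_antidiagonal_eq_sum_range_succ
    fun i j => (if i = 0 then 0 else v i) * doc b j, Nat.succ_eq_add_one, Finset.sum_range_succ',
    docConv, sum_Icc_one_eq_sum_range]
  simp [mul_comm]

/-- Convolving with `b` inverts the DOC convolution. Since `docConv b v 0 = 0`, truncated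
subtraction realises the extension of `docConv b v` by zero to negative indices. -/
theorem sum_mul_docConv {b : ℕ → ℝ} (hb : b 0 ≠ 0) {k : ℕ} (hk : ∀ s, k ≤ s → b s = 0)
    (v : ℕ → ℝ) (n : ℕ) :
    ∑ s ∈ Finset.range k, b s * docConv b v (n + 1 - s) = v (n + 1) := by
  have h : PowerSeries.mk b * PowerSeries.mk (docConv b v) =
      PowerSeries.mk fun n => if n = 0 then 0 else v n := by
    rw [mk_docConv, ← mul_assoc, mk_mul_mk_doc hb, one_mul]
  replace h := congrArg (PowerSeries.coeff (n + 1)) h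
  rw [PowerSeries.coeff_mul] at h
  simp only [PowerSeries.coeff_mk] at h
  rw [Finset.Nat.sum_antidiagonal_eq_sum_range_succ fun i j => b i * docConv b v j] at h
  rw [if_neg (Nat.succ_ne_zero n)] at h
  rw [← h, Finset.sum_subset (Finset.range_mono (Nat.le_add_right k (n + 2))),
    Finset.sum_subset (Finset.range_mono (Nat.le_add_left (n + 2) k))]
  · intro s _ hs
    rw [Finset.mem_range, not_lt] at hs
    rw [Nat.sub_eq_zero_of_le (by omega), docConv_zero, mul_zero]
  · intro s _ hs
    rw [hk s (by simpa using hs), zero_mul]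

/-- A dissipation inequality with nonnegative storage `S`, initially zero, bounds the DOC quadratic
form. -/
theorem doc_quadratic_form_le_of_storage {b v S : ℕ → ℝ} {C : ℝ} (h0 : S 0 = 0) (hS : ∀ n, 0 ≤ S n)
    (hdiss : ∀ n, S (n + 1) - S n ≤
      C * v (n + 1) ^ 2 - 2 * (docConv b v (n + 1) * v (n + 1))) (m : ℕ) :
    2 * ∑ ℓ ∈ Finset.Icc 1 m, ∑ j ∈ Finset.Icc 1 ℓ, doc b (ℓ - j) * v j * v ℓ ≤
      C * ∑ ℓ ∈ Finset.Icc 1 m, v ℓ ^ 2 := by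
  simp only [← Finset.sum_mul]
  change 2 * ∑ ℓ ∈ Finset.Icc 1 m, docConv b v ℓ * v ℓ ≤ _
  have h := Finset.sum_le_sum fun n (_ : n ∈ Finset.range m) => hdiss n
  rw [Finset.sum_range_sub, h0, Finset.sum_sub_distrib, ← Finset.mul_sum, ← Finset.mul_sum,
    ← sum_Icc_one_eq_sum_range fun n => v n ^ 2,
    ← sum_Icc_one_eq_sum_range fun n => docConv b v n * v n] at h
  linarith [hS m]

/-- Storage function certifying the BDF-3 bound. -/
noncomputable def storage3 (x y : ℝ) : ℝ :=
  2 * x ^ 2 - x * y + 1 / 2 * y ^ 2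

theorem storage3_nonneg (x y : ℝ) : 0 ≤ storage3 x y := by
  unfold storage3
  nlinarith [sq_nonneg (4 * x - y),
    sq_nonneg y]

theorem storage3_sub_le (x y z : ℝ) :
    storage3 x y - storage3 y z ≤
      35 / 12 * (11 / 6 * x - 7 / 6 * y + 1 / 3 * z) ^ 2 -
        2 * (x * (11 / 6 * x - 7 / 6 * y + 1 / 3 * z)) := by
  unfold storage3
  nlinarith [sq_nonneg (1787 * x - 1975 * y + 626 * z),
    sq_nonneg (497 * y - 39 * z),
    sq_nonneg z]

theorem doc_bdf3_quadratic_form_le (v : ℕ → ℝ) (m : ℕ) :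
    2 * ∑ ℓ ∈ Finset.Icc 1 m, ∑ j ∈ Finset.Icc 1 ℓ, doc bdf3 (ℓ - j) * v j * v ℓ ≤
      35 / 12 * ∑ ℓ ∈ Finset.Icc 1 m, v ℓ ^ 2 := by
  let w := docConv bdf3 v
  refine doc_quadratic_form_le_of_storage
    (S := fun n => storage3 (w n) (w (n - 1))) ?_
    (fun n => storage3_nonneg ..) (fun n => ?_) m
  · simp [w, docConv_zero, storage3]
  · have hv : ∑ s ∈ Finset.range 3, bdf3 s * w (n + 1 - s) = v (n + 1) :=
      sum_mul_docConv (by norm_num [bdf3])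
        (fun s hs => by obtain ⟨s, rfl⟩ := Nat.exists_eq_add_of_le' hs; rfl) v n
    have h := storage3_sub_le (w (n + 1)) (w n) (w (n - 1))
    simp only [Finset.sum_range_succ, Finset.sum_range_zero, bdf3, Nat.sub_zero,
      Nat.reduceSubDiff, Nat.add_sub_cancel] at hv
    simp only [Nat.add_sub_cancel]
    convert h using 3 <;> (try rw [← hv]) <;> ring

/-- Storage function certifying the BDF-4 bound. -/
noncomputable def storage4 (x y z : ℝ) : ℝ :=
  11 * x ^ 2 - 10 * x * y + 2 * x * z + 6 * y ^ 2 - 2 * y * z + z ^ 2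

theorem storage4_nonneg (x y z : ℝ) : 0 ≤ storage4 x y z := by
  unfold storage4
  nlinarith [sq_nonneg (11 * x - 5 * y + z),
    sq_nonneg (41 * y - 6 * z),
    sq_nonneg z]

theorem storage4_sub_le (x y z t : ℝ) :
    storage4 x y z - storage4 y z t ≤
      7 * (25 / 12 * x - 23 / 12 * y + 13 / 12 * z - 1 / 4 * t) ^ 2 -
        2 * (x * (25 / 12 * x - 23 / 12 * y + 13 / 12 * z - 1 / 4 * t)) := by
  unfold storage4
  nlinarith [sq_nonneg (2191 * x - 3029 * y + 1975 * z - 489 * t),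
    sq_nonneg (3583 * y + 934 * z - 746 * t),
    sq_nonneg (531 * z + 182 * t),
    sq_nonneg t]

theorem doc_bdf4_quadratic_form_le (v : ℕ → ℝ) (m : ℕ) :
    2 * ∑ ℓ ∈ Finset.Icc 1 m, ∑ j ∈ Finset.Icc 1 ℓ, doc bdf4 (ℓ - j) * v j * v ℓ ≤
      7 * ∑ ℓ ∈ Finset.Icc 1 m, v ℓ ^ 2 := by
  let w := docConv bdf4 v
  refine doc_quadratic_form_le_of_storage
    (S := fun n => storage4 (w n) (w (n - 1)) (w (n - 2))) ?_
    (fun n => storage4_nonneg ..) (fun n => ?_) m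
  · simp [w, docConv_zero, storage4]
  · have hv : ∑ s ∈ Finset.range 4, bdf4 s * w (n + 1 - s) = v (n + 1) :=
      sum_mul_docConv (by norm_num [bdf4])
        (fun s hs => by obtain ⟨s, rfl⟩ := Nat.exists_eq_add_of_le' hs; rfl) v n
    have h := storage4_sub_le (w (n + 1)) (w n) (w (n - 1)) (w (n - 2))
    simp only [Finset.sum_range_succ, Finset.sum_range_zero, bdf4, Nat.sub_zero,
      Nat.reduceSubDiff, Nat.add_sub_cancel] at hv
    simp only [Nat.reduceSubDiff, Nat.add_sub_cancel]
    convert h using 3 <;> (try rw [← hv]) <;> ring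

/-- Storage function certifying the BDF-5 bound. -/
noncomputable def storage5 (x y z t : ℝ) : ℝ :=
  15 / 2 * x ^ 2 - 11 * x * y + 5 * x * z - x * t + 7 * y ^ 2 - 6 * y * z + y * t +
    5 / 2 * z ^ 2 - z * t + 1 / 2 * t ^ 2

theorem storage5_nonneg (x y z t : ℝ) : 0 ≤ storage5 x y z t := by
  unfold storage5
  nlinarith [sq_nonneg (15 * x - 11 * y + 5 * z - t),
    sq_nonneg (89 * y - 35 * z + 4 * t),
    sq_nonneg (43 * z - 10 * t),
    sq_nonneg t]

theorem storage5_sub_le (x y z t u : ℝ) :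
    storage5 x y z t - storage5 y z t u ≤
      168 / 5 * (137 / 60 * x - 163 / 60 * y + 137 / 60 * z - 21 / 20 * t + 1 / 5 * u) ^ 2 -
        2 * (x * (137 / 60 * x - 163 / 60 * y + 137 / 60 * z - 21 / 20 * t + 1 / 5 * u)) := by
  unfold storage5
  nlinarith [sq_nonneg (244666 * x - 300309 * y + 255591 * z - 118509 * t + 22716 * u),
    sq_nonneg (8043499 * y - 5217041 * z + 2554647 * t - 492912 * u),
    sq_nonneg (8401580 * z + 678723 * t - 1369198 * u),
    sq_nonneg (8335409 * t - 2696834 * u),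
    sq_nonneg u]

theorem doc_bdf5_quadratic_form_le (v : ℕ → ℝ) (m : ℕ) :
    2 * ∑ ℓ ∈ Finset.Icc 1 m, ∑ j ∈ Finset.Icc 1 ℓ, doc bdf5 (ℓ - j) * v j * v ℓ ≤
      168 / 5 * ∑ ℓ ∈ Finset.Icc 1 m, v ℓ ^ 2 := by
  let w := docConv bdf5 v
  refine doc_quadratic_form_le_of_storage
    (S := fun n => storage5 (w n) (w (n - 1)) (w (n - 2)) (w (n - 3))) ?_
    (fun n => storage5_nonneg ..) (fun n => ?_) m
  · simp [w, docConv_zero, storage5]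
  · have hv : ∑ s ∈ Finset.range 5, bdf5 s * w (n + 1 - s) = v (n + 1) :=
      sum_mul_docConv (by norm_num [bdf5])
        (fun s hs => by obtain ⟨s, rfl⟩ := Nat.exists_eq_add_of_le' hs; rfl) v n
    have h := storage5_sub_le (w (n + 1)) (w n) (w (n - 1)) (w (n - 2)) (w (n - 3))
    simp only [Finset.sum_range_succ, Finset.sum_range_zero, bdf5, Nat.sub_zero,
      Nat.reduceSubDiff, Nat.add_sub_cancel] at hv
    simp only [Nat.reduceSubDiff, Nat.add_sub_cancel]
    convert h using 3 <;> (try rw [← hv]) <;> ring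

theorem doc_bdf_quadratic_form_upper_bounds (m : ℕ) (hm : 1 ≤ m) (v : ℕ → ℝ) :
    (2 * ∑ ℓ ∈ Finset.Icc 1 m, ∑ j ∈ Finset.Icc 1 ℓ, doc bdf3 (ℓ - j) * v j * v ℓ ≤
        35/12 * ∑ ℓ ∈ Finset.Icc 1 m, (v ℓ)^2) ∧
    (2 * ∑ ℓ ∈ Finset.Icc 1 m, ∑ j ∈ Finset.Icc 1 ℓ, doc bdf4 (ℓ - j) * v j * v ℓ ≤
        7 * ∑ ℓ ∈ Finset.Icc 1 m, (v ℓ)^2) ∧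
    (2 * ∑ ℓ ∈ Finset.Icc 1 m, ∑ j ∈ Finset.Icc 1 ℓ, doc bdf5 (ℓ - j) * v j * v ℓ ≤
        168/5 * ∑ ℓ ∈ Finset.Icc 1 m, (v ℓ)^2) := by
  exact ⟨doc_bdf3_quadratic_form_le v m, doc_bdf4_quadratic_form_le v m,
    doc_bdf5_quadratic_form_le v m⟩
end

section
/- Let θ_j^{(k)} denote the DOC kernels associated with the BDF-k kernels. Then for each k ∈ {3, 4, 5} the DOC-k kernels are positive definite: for every m ≥ 1 and all real numbers v₁, …, v_m not all zero, ∑_{ℓ=1}^{m} v_ℓ · ∑_{j=1}^{ℓ} θ_{ℓ−j}^{(k)} v_j > 0. -/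
open PowerSeries in
theorem mk_doc_mul_mk {b : ℕ → ℝ} (hb : b 0 ≠ 0) : mk (doc b) * mk b = 1 := by
  ext n
  rw [mul_comm, coeff_mul, Finset.Nat.sum_antidiagonal_eq_sum_range_succ_mk, coeff_one]
  cases n with
  | zero => simp [doc, hb]
  | succ n =>
    have hIcc : ∑ s ∈ Finset.Icc 1 (n + 1), doc b (n + 1 - s) * b s
        = ∑ s ∈ Finset.range (n + 1), b (s + 1) * doc b (n - s) := by
      rw [← Finset.Ico_add_one_right_eq_Icc, Finset.sum_Ico_eq_sum_range]
      refine Finset.sum_congr (by simp) fun s _ => ?_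
      rw [show n + 1 - (1 + s) = n - s by omega, add_comm 1 s, mul_comm]
    rw [Finset.sum_range_succ']
    simp only [coeff_mk, Nat.add_sub_add_right, Nat.sub_zero]
    rw [doc, Finset.sum_attach _ (fun s => doc b (n + 1 - s) * b s), hIcc]
    simp [hb]

open PowerSeries in
/-- The DOC transform of `v`, padded with four leading zeros, is inverted by convolution with `b`. -/
theorem exists_doc_convolution {b : ℕ → ℝ} (hb : b 0 ≠ 0) (hsupp : ∀ j, b (j + 5) = 0)
    (v : ℕ → ℝ) :
    ∃ u : ℕ → ℝ, (∀ n < 4, u n = 0) ∧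
      (∀ n, u (n + 4) = ∑ j ∈ Finset.Icc 1 (n + 1), doc b (n + 1 - j) * v j) ∧
      ∀ n, v (n + 1) = b 0 * u (n + 4) + b 1 * u (n + 3) + b 2 * u (n + 2) + b 3 * u (n + 1)
        + b 4 * u n := by
  set V : ℝ⟦X⟧ := mk fun n => v (n + 1) with hV
  set U : ℝ⟦X⟧ := mk (doc b) * V * X ^ 4 with hU
  refine ⟨fun n => coeff n U, fun n hn => ?_, fun n => ?_, fun n => ?_⟩
  · simp only [hU, coeff_mul_X_pow', if_neg hn.not_ge]
  · simp only [hU, hV, coeff_mul_X_pow]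
    rw [mul_comm, coeff_mul, Finset.Nat.sum_antidiagonal_eq_sum_range_succ_mk,
      ← Finset.Ico_add_one_right_eq_Icc, Finset.sum_Ico_eq_sum_range]
    refine Finset.sum_congr (by simp) fun j _ => ?_
    simp only [coeff_mk]
    rw [show n + 1 - (1 + j) = n - j by omega, add_comm 1 j, mul_comm]
  · have hinv : mk b * U = V * X ^ 4 := by
      rw [hU, ← mul_assoc, ← mul_assoc, mul_comm (mk b), mk_doc_mul_mk hb, one_mul]
    have hcoeff := congrArg (coeff (n + 4)) hinv
    rw [coeff_mul_X_pow, hV, coeff_mk, coeff_mul,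
      Finset.Nat.sum_antidiagonal_eq_sum_range_succ_mk] at hcoeff
    rw [← hcoeff, show (n + 4).succ = 5 + n by omega, Finset.sum_range_add,
      Finset.sum_eq_zero (s := Finset.range n) fun j _ => by simp [add_comm 5 j, hsupp]]
    simp [Finset.sum_range_succ]

/-- A kernel supported on `{0, …, 4}` whose quadratic form dominates a multiple of the squares up
to the increments of a nonnegative storage function `G` has positive definite DOC kernels. -/
theorem doc_quadratic_form_pos {b : ℕ → ℝ} (hb : b 0 ≠ 0) (hsupp : ∀ j, b (j + 5) = 0)
    {ε : ℝ} (hε : 0 < ε) (G : ℝ → ℝ → ℝ → ℝ → ℝ) (hG₀ : G 0 0 0 0 = 0)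
    (hG : ∀ x y z w, 0 ≤ G x y z w)
    (hstep : ∀ x y z w t, ε * x ^ 2 + G x y z w ≤
      x * (b 0 * x + b 1 * y + b 2 * z + b 3 * w + b 4 * t) + G y z w t)
    {m : ℕ} {v : ℕ → ℝ} (hv : ∃ ℓ ∈ Finset.Icc 1 m, v ℓ ≠ 0) :
    0 < ∑ ℓ ∈ Finset.Icc 1 m, v ℓ * ∑ j ∈ Finset.Icc 1 ℓ, doc b (ℓ - j) * v j := by
  obtain ⟨u, hu0, hu, hbu⟩ := exists_doc_convolution hb hsupp v
  have hsum : ∑ ℓ ∈ Finset.Icc 1 m, v ℓ * ∑ j ∈ Finset.Icc 1 ℓ, doc b (ℓ - j) * v j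
      = ∑ n ∈ Finset.range m, v (n + 1) * u (n + 4) := by
    rw [← Finset.Ico_add_one_right_eq_Icc, Finset.sum_Ico_eq_sum_range]
    refine Finset.sum_congr (by simp) fun n _ => ?_
    rw [hu, add_comm 1 n]
  have hlower : ∀ k, ε * ∑ n ∈ Finset.range k, u (n + 4) ^ 2
      + G (u (k + 3)) (u (k + 2)) (u (k + 1)) (u k)
      ≤ ∑ n ∈ Finset.range k, v (n + 1) * u (n + 4) := by
    intro k
    induction k with
    | zero => simp [hu0, hG₀]
    | succ k ih =>
      rw [Finset.sum_range_succ, Finset.sum_range_succ, hbu]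
      have := hstep (u (k + 4)) (u (k + 3)) (u (k + 2)) (u (k + 1)) (u k)
      rw [show k + 1 + 3 = k + 4 by rfl, show k + 1 + 2 = k + 3 by rfl,
        show k + 1 + 1 = k + 2 by rfl]
      linarith
  have hsq : 0 < ∑ n ∈ Finset.range m, u (n + 4) ^ 2 := by
    by_contra! hle
    have hzero := (Finset.sum_eq_zero_iff_of_nonneg fun n _ => sq_nonneg (u (n + 4))).1
      (hle.antisymm (Finset.sum_nonneg fun n _ => sq_nonneg _))
    have huz : ∀ n < m + 4, u n = 0 := by
      intro n hn
      rcases lt_or_ge n 4 with h | h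
      · exact hu0 n h
      · obtain ⟨k, rfl⟩ := Nat.exists_eq_add_of_le' h
        exact pow_eq_zero_iff two_ne_zero |>.1 (hzero k (Finset.mem_range.2 (by omega)))
    obtain ⟨ℓ, hℓ, hne⟩ := hv
    rw [Finset.mem_Icc] at hℓ
    obtain ⟨n, rfl⟩ := Nat.exists_eq_add_of_le' hℓ.1
    apply hne
    rw [hbu, huz (n + 4) (by omega), huz (n + 3) (by omega), huz (n + 2) (by omega),
      huz (n + 1) (by omega), huz n (by omega)]
    simp
  rw [hsum]
  linarith [hlower m, mul_pos hε hsq, hG (u (m + 3)) (u (m + 2)) (u (m + 1)) (u m)]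

theorem doc_bdf_kernels_positive_definite (m : ℕ) (hm : 1 ≤ m) (v : ℕ → ℝ)
    (hv : ∃ ℓ ∈ Finset.Icc 1 m, v ℓ ≠ 0) :
    (0 < ∑ ℓ ∈ Finset.Icc 1 m, v ℓ * ∑ j ∈ Finset.Icc 1 ℓ, doc bdf3 (ℓ - j) * v j) ∧
    (0 < ∑ ℓ ∈ Finset.Icc 1 m, v ℓ * ∑ j ∈ Finset.Icc 1 ℓ, doc bdf4 (ℓ - j) * v j) ∧
    (0 < ∑ ℓ ∈ Finset.Icc 1 m, v ℓ * ∑ j ∈ Finset.Icc 1 ℓ, doc bdf5 (ℓ - j) * v j) := by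
  refine ⟨?_, ?_, ?_⟩
  · refine doc_quadratic_form_pos (by norm_num [bdf3]) (fun _ => rfl) (ε := 1 / 100) (by norm_num)
      (fun a b _ _ => 3 / 2 * a ^ 2 - a * b + 1 / 2 * b ^ 2)
      (by norm_num) (fun a b c d => ?_) (fun a b c d e => ?_) hv
    · nlinarith [sq_nonneg (a - 1 / 3 * b),
        sq_nonneg b]
    · simp only [bdf3]
      nlinarith [sq_nonneg (a - 25 / 97 * b + 50 / 97 * c),
        sq_nonneg (b - 532 / 1139 * c),
        sq_nonneg c]
  · refine doc_quadratic_form_pos (by norm_num [bdf4]) (fun _ => rfl) (ε := 1 / 100) (by norm_num)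
      (fun a b c _ => 5 / 3 * a ^ 2 - 4 / 3 * a * b + 2 / 3 * a * c + b ^ 2 - 2 / 3 * b * c + 1 / 3 * c ^ 2)
      (by norm_num) (fun a b c d => ?_) (fun a b c d e => ?_) hv
    · nlinarith [sq_nonneg (a - 2 / 5 * b + 1 / 5 * c),
        sq_nonneg (b - 3 / 11 * c),
        sq_nonneg c]
    · simp only [bdf4]
      nlinarith [sq_nonneg (a - 175 / 244 * b + 125 / 244 * c - 75 / 244 * d),
        sq_nonneg (b - 359 / 893 * c + 1427 / 2679 * d),
        sq_nonneg (c - 153 / 434 * d),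
        sq_nonneg d]
  · refine doc_quadratic_form_pos (by norm_num [bdf5]) (fun _ => rfl) (ε := 1 / 100) (by norm_num)
      (fun a b c d => 23 / 12 * a ^ 2 - 13 / 6 * a * b + 3 / 2 * a * c - 1 / 2 * a * d + 3 / 2 * b ^ 2
        - 4 / 3 * b * c + 2 / 3 * b * d + 5 / 6 * c ^ 2 - 1 / 2 * c * d + 1 / 3 * d ^ 2)
      (by norm_num) (fun a b c d => ?_) (fun a b c d e => ?_) hv
    · nlinarith [sq_nonneg (a - 13 / 23 * b + 9 / 23 * c - 3 / 23 * d),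
        sq_nonneg (b - 67 / 245 * c + 53 / 245 * d),
        sq_nonneg (c - 293 / 1392 * d),
        sq_nonneg d]
    · simp only [bdf5]
      nlinarith [sq_nonneg (a - 165 / 214 * b + 235 / 214 * c - 165 / 214 * d + 30 / 107 * e),
        sq_nonneg (b - 589 / 1051 * c + d - 888 / 1051 * e),
        sq_nonneg (c + 1597 / 2173 * e),
        sq_nonneg d,
        sq_nonneg e]
end
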